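/- Gaussian type-class covering bound: for positive reals Λ > D > 0 and any n ≥ 1, there exists a set ℬ ⊂ ℝⁿ with |ℬ| ≤ 6·n^{5/2}·(Λ/D)^{n/2} such that every x^n ∈ ℝⁿ with ‖x^n‖² ≤ nΛ lies within squared-distance nD of some point of ℬ, i.e., the ball of radius √(nΛ) in ℝⁿ can be covered by at most 6·n^{5/2}·(Λ/D)^{n/2} balls of radius √(nD). -/

import Mathlib

open Real Finset

section
open MeasureTheory Metric Module

variable {E : Type*} [NormedAddCommGroup E] [InnerProductSpace ℝ E] [FiniteDimensional ℝ E]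
  [MeasurableSpace E] [BorelSpace E]

/-- A set whose `δ`-neighbourhood has finite measure is covered by the unit balls centred at a
maximal `1`-separated subset, whose cardinality is bounded by comparing volumes. -/
lemma exists_finset_unit_cover (μ : Measure E) [μ.IsAddHaarMeasure] {A U : Set E} {δ : ℝ}
    (hδ : 0 < δ) (hδ' : 2 * δ ≤ 1) (hU : μ U ≠ ⊤) (hAU : ∀ x ∈ A, ball x δ ⊆ U) :
    ∃ M : Finset E, M.card * (δ ^ finrank ℝ E * μ.real (ball 0 1)) ≤ μ.real U ∧
      ∀ x ∈ A, ∃ y ∈ M, dist x y ≤ 1 := by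
  classical
  set w := δ ^ finrank ℝ E * μ.real (ball (0 : E) 1) with hw
  have hw0 : 0 < w := mul_pos (pow_pos hδ _)
    (ENNReal.toReal_pos (measure_ball_pos μ 0 one_pos).ne' measure_ball_lt_top.ne)
  have key : ∀ C : Finset E, (C : Set E) ⊆ A → (C : Set E).Pairwise (fun x y => 1 < dist x y) →
      C.card * w ≤ μ.real U := by
    intro C hCA hC
    have hdisj : (C : Set E).PairwiseDisjoint (fun x => ball x δ) := by
      intro x hx y hy hxy
      exact ball_disjoint_ball (by linarith [hC hx hy hxy])
    calc C.card * w = ∑ x ∈ C, μ.real (ball x δ) := by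
          simp [hw, measureReal_def, Measure.addHaar_ball_of_pos μ _ hδ, hδ.le]
      _ = μ.real (⋃ x ∈ C, ball x δ) :=
          (measureReal_biUnion_finset hdisj (fun x _ => measurableSet_ball)
            (fun _ _ => measure_ball_lt_top.ne)).symm
      _ ≤ μ.real U := measureReal_mono (Set.iUnion₂_subset fun x hx => hAU x (hCA hx)) hU
  let T : Set ℕ := {m | ∃ C : Finset E, C.card = m ∧ (C : Set E) ⊆ A ∧
    (C : Set E).Pairwise (fun x y => 1 < dist x y)}
  have hT : BddAbove T := by
    refine ⟨⌊μ.real U / w⌋₊, ?_⟩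
    rintro _ ⟨C, rfl, hCA, hC⟩
    exact Nat.le_floor ((le_div_iff₀ hw0).2 (key C hCA hC))
  obtain ⟨M, hMcard, hMA, hM⟩ := Nat.sSup_mem (s := T) ⟨0, ∅, by simp⟩ hT
  refine ⟨M, key M hMA hM, fun x hx => ?_⟩
  by_contra! h
  have hxM : x ∉ M := fun hxM => by simpa using (h x hxM).trans_le' zero_le_one
  have hmem : M.card + 1 ∈ T := by
    refine ⟨insert x M, card_insert_of_notMem hxM, ?_, ?_⟩
    · simpa [Set.insert_subset_iff] using ⟨hx, hMA⟩
    · rw [coe_insert]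
      refine hM.insert fun y hy _ => ⟨h y hy, ?_⟩
      rw [dist_comm]; exact h y hy
  have := le_csSup hT hmem
  omega

/-- Double counting: if every closed ball centred in `U` captures a proportion `p` of `S`, then
some closed ball captures a proportion `p` of `U`. -/
lemma exists_measure_inter_closedBall_ge (μ : Measure E) [μ.IsAddHaarMeasure] {S U : Set E}
    {p t : ℝ} (hS : MeasurableSet S) (hS0 : μ S ≠ 0) (hS' : μ S ≠ ⊤)
    (hU : MeasurableSet U) (hU' : μ U ≠ ⊤)
    (h : ∀ x ∈ U, p * μ.real S ≤ μ.real (S ∩ closedBall x t)) :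
    ∃ y, p * μ.real U ≤ μ.real (U ∩ closedBall y t) := by
  have hmeas : MeasurableSet {q : E × E | dist q.1 q.2 ≤ t} :=
    measurableSet_le measurable_dist measurable_const
  have hsec (V : Set E) (hV : MeasurableSet V) (y : E) :
      μ.restrict V {x | dist x y ≤ t} = μ (V ∩ closedBall y t) := by
    rw [Measure.restrict_apply' hV, Set.inter_comm]; rfl
  have hswap : ∫⁻ y in S, μ (U ∩ closedBall y t) ∂μ = ∫⁻ x in U, μ (S ∩ closedBall x t) ∂μ := by
    have h1 := Measure.prod_apply (μ := μ.restrict S) (ν := μ.restrict U) hmeas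
    have h2 := Measure.prod_apply_symm (μ := μ.restrict S) (ν := μ.restrict U) hmeas
    rw [h1] at h2
    simp only [Set.preimage_ofPred_eq] at h2
    simp_rw [hsec S hS] at h2
    rw [← h2]
    refine lintegral_congr fun y => ?_
    rw [← hsec U hU]
    simp only [dist_comm]
  have hlow : ENNReal.ofReal (p * μ.real S) * μ U ≤ ∫⁻ y in S, μ (U ∩ closedBall y t) ∂μ := by
    rw [hswap, ← setLIntegral_const]
    refine setLIntegral_mono' hU fun x hx => ?_
    exact ENNReal.ofReal_le_of_le_toReal (h x hx)
  have hfin : ∫⁻ y in S, μ (U ∩ closedBall y t) ∂μ ≠ ⊤ := by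
    refine ne_top_of_le_ne_top (ENNReal.mul_ne_top hU' hS') ?_
    rw [← setLIntegral_const]
    exact lintegral_mono fun y => measure_mono Set.inter_subset_left
  obtain ⟨y, -, hy⟩ := exists_setLAverage_le hS0 hS.nullMeasurableSet hfin
  refine ⟨y, ?_⟩
  rw [setLAverage_eq] at hy
  have hUy : μ (U ∩ closedBall y t) ≠ ⊤ := measure_ne_top_of_subset Set.inter_subset_left hU'
  rcases le_or_gt p 0 with hp | hp
  · exact (mul_nonpos_of_nonpos_of_nonneg hp measureReal_nonneg).trans measureReal_nonneg
  have h3 := (ENNReal.div_le_iff hS0 hS').1 ((ENNReal.div_le_div_right hlow _).trans hy)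
  have h4 := ENNReal.toReal_mono (ENNReal.mul_ne_top hUy hS') h3
  rw [ENNReal.toReal_mul, ENNReal.toReal_mul, ENNReal.toReal_ofReal (by positivity)] at h4
  have hS1 : 0 < μ.real S := ENNReal.toReal_pos hS0 hS'
  refine le_of_mul_le_mul_right ?_ hS1
  simpa [measureReal_def, mul_right_comm] using h4

/-- Greedy choice of centres: `N` closed balls suffice to leave at most a proportion `(1 - p) ^ N`
of `U` uncovered. -/
lemma exists_finset_measure_diff_le (μ : Measure E) [μ.IsAddHaarMeasure] {S U : Set E}
    {p t : ℝ} (hS : MeasurableSet S) (hS0 : μ S ≠ 0) (hS' : μ S ≠ ⊤)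
    (hU : MeasurableSet U) (hU' : μ U ≠ ⊤) (hp : p ≤ 1)
    (h : ∀ x ∈ U, p * μ.real S ≤ μ.real (S ∩ closedBall x t)) (N : ℕ) :
    ∃ Y : Finset E, Y.card ≤ N ∧
      μ.real (U \ ⋃ y ∈ Y, closedBall y t) ≤ (1 - p) ^ N * μ.real U := by
  classical
  induction N with
  | zero => exact ⟨∅, by simp⟩
  | succ N ih =>
    obtain ⟨Y, hY, hYU⟩ := ih
    set V := U \ ⋃ y ∈ Y, closedBall y t with hV
    have hVm : MeasurableSet V :=
      hU.diff (Y.measurableSet_biUnion fun _ _ => measurableSet_closedBall)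
    have hV' : μ V ≠ ⊤ := measure_ne_top_of_subset Set.sdiff_subset hU'
    obtain ⟨y, hy⟩ := exists_measure_inter_closedBall_ge μ hS hS0 hS' hVm hV'
      (fun x hx => h x hx.1)
    refine ⟨insert y Y, (card_insert_le _ _).trans (by omega), ?_⟩
    have hset : U \ ⋃ z ∈ insert y Y, closedBall z t = V \ closedBall y t := by
      rw [set_biUnion_insert, Set.union_comm, hV, Set.sdiff_sdiff]
    have hadd := measureReal_inter_add_sdiff (μ := μ) (s := V)
      (measurableSet_closedBall (x := y) (ε := t)) hV'
    rw [hset, pow_succ]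
    calc μ.real (V \ closedBall y t) ≤ (1 - p) * μ.real V := by linarith
      _ ≤ (1 - p) * ((1 - p) ^ N * μ.real U) := by gcongr
      _ = _ := by ring

lemma half_measure_ball_le (μ : Measure E) [μ.IsAddHaarMeasure] (e : E) :
    μ.real (ball 0 1) / 2 ≤ μ.real {w : E | ‖w‖ ≤ 1 ∧ 0 ≤ inner ℝ e w} := by
  set H := {w : E | ‖w‖ ≤ 1 ∧ 0 ≤ inner ℝ e w} with hH
  have hHsub : H ⊆ closedBall 0 1 := fun w hw => by simpa using hw.1
  have hsub : ball 0 1 ⊆ H ∪ -H := by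
    intro w hw
    have hw1 : ‖w‖ ≤ 1 := by simpa using (mem_ball_zero_iff.1 hw).le
    rcases le_total 0 (inner ℝ e w) with h | h
    · exact Or.inl ⟨hw1, h⟩
    · exact Or.inr ⟨by simpa using hw1, by simpa [inner_neg_right] using h⟩
  have hHfin : μ H ≠ ⊤ := measure_ne_top_of_subset hHsub measure_closedBall_lt_top.ne
  have hneg : μ.real (-H) = μ.real H := by
    simp [measureReal_def]
  have h1 : μ.real (ball 0 1) ≤ μ.real (H ∪ -H) :=
    measureReal_mono hsub (measure_union_ne_top hHfin (by simpa using hHfin))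
  have h2 := measureReal_union_le (μ := μ) H (-H)
  linarith

/-- A ball of radius `r` cut by a hyperplane at distance `k` from its centre contains half of an
ellipsoid whose centre lies on the hyperplane. -/
lemma measure_cap_ge (μ : Measure E) [μ.IsAddHaarMeasure] {e : E} (he : ‖e‖ = 1)
    {r k h a b : ℝ} (hr : 0 ≤ r) (hk : 0 ≤ k) (hkh : k ≤ h) (hh : h ^ 2 + k ^ 2 = r ^ 2)
    (ha : 0 < a) (hb : 0 < b)
    (hab : ∀ z : ℝ, 0 ≤ z → 2 * a * z + b ^ 2 * (1 - z ^ 2) + a ^ 2 * z ^ 2 ≤ 1) :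
    h ^ finrank ℝ E * (b ^ finrank ℝ E * (a / b)) * (μ.real (ball 0 1) / 2) ≤
      μ.real {z : E | ‖z‖ ≤ r ∧ k ≤ inner ℝ e z} := by
  have hh0 : 0 ≤ h := hk.trans hkh
  let T : E →ₗ[ℝ] E := (h * b) • LinearMap.transvection (innerₗ E e) ((a / b - 1) • e)
  have hT : ∀ w, T w = (h * b) • w + (h * (a - b) * inner ℝ e w) • e := by
    intro w
    simp only [T, LinearMap.smul_apply, LinearMap.transvection.apply, innerₗ_apply_apply, smul_add,
      smul_smul]
    congr 2
    field_simp
  have hdet : LinearMap.det T = h ^ finrank ℝ E * (b ^ finrank ℝ E * (a / b)) := by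
    simp [T, LinearMap.det_smul, LinearMap.transvection.det, he, mul_pow]
    ring
  set H := {w : E | ‖w‖ ≤ 1 ∧ 0 ≤ inner ℝ e w} with hH
  have hcap : {z : E | ‖z‖ ≤ r ∧ k ≤ inner ℝ e z} ⊆ closedBall 0 r :=
    fun w hw => by simpa using hw.1
  have hee : inner ℝ e e = (1 : ℝ) := by rw [real_inner_self_eq_norm_sq, he]; norm_num
  have hsub : (fun z => k • e + z) '' (T '' H) ⊆ {z : E | ‖z‖ ≤ r ∧ k ≤ inner ℝ e z} := by
    rintro _ ⟨_, ⟨w, ⟨hw1, hw0⟩, rfl⟩, rfl⟩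
    set z : ℝ := inner ℝ e w with hz
    have hin : inner ℝ e (k • e + T w) = k + h * a * z := by
      simp only [hT, inner_add_right, inner_smul_right, hee, ← hz]; ring
    refine ⟨?_, ?_⟩
    · have hnorm : ‖k • e + T w‖ ^ 2 = k ^ 2 + 2 * k * h * a * z +
          h ^ 2 * (b ^ 2 * (‖w‖ ^ 2 - z ^ 2) + a ^ 2 * z ^ 2) := by
        rw [← real_inner_self_eq_norm_sq, hT]
        simp only [inner_add_right, inner_add_left, inner_smul_right, real_inner_smul_left, hee,
          real_inner_comm e w, ← hz]
        rw [real_inner_self_eq_norm_sq]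
        ring
      refine abs_le_of_sq_le_sq' ?_ hr |>.2
      have hw2 : ‖w‖ ^ 2 ≤ 1 := by nlinarith [norm_nonneg w]
      have h1 : 2 * k * h * a * z ≤ 2 * h * h * a * z := by gcongr
      have h2 : b ^ 2 * (‖w‖ ^ 2 - z ^ 2) ≤ b ^ 2 * (1 - z ^ 2) := by gcongr
      have h3 := mul_le_mul_of_nonneg_left (hab z hw0) (sq_nonneg h)
      have h4 := mul_le_mul_of_nonneg_left h2 (sq_nonneg h)
      rw [hnorm, ← hh]
      linarith
    · change k ≤ inner ℝ e (k • e + T w)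
      rw [hin]
      have : 0 ≤ h * a * z := by positivity
      linarith
  calc _ ≤ h ^ finrank ℝ E * (b ^ finrank ℝ E * (a / b)) * μ.real H := by
        gcongr; exact half_measure_ball_le μ e
    _ = μ.real ((fun z => k • e + z) '' (T '' H)) := by
        rw [measureReal_def, measureReal_def, Set.image_add_left, measure_preimage_add,
          Measure.addHaar_image_linearMap, hdet, ENNReal.toReal_mul, abs_of_nonneg (by positivity),
          ENNReal.toReal_ofReal (by positivity)]
    _ ≤ _ := measureReal_mono hsub (measure_ne_top_of_subset hcap measure_closedBall_lt_top.ne)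

/-- Every ball of radius `t` centred in the ball of radius `P > t` contains a sizeable part of the
ball of radius `√(P² - t²)`. -/
lemma measure_inter_closedBall_ge [Nontrivial E] (μ : Measure E) [μ.IsAddHaarMeasure]
    {P t s a b : ℝ} (ht : 0 < t) (hs : 0 < s) (hP : 0 < P) (hst : s ^ 2 + t ^ 2 = P ^ 2)
    (ha : 0 < a) (hb : 0 < b)
    (hab : ∀ z : ℝ, 0 ≤ z → 2 * a * z + b ^ 2 * (1 - z ^ 2) + a ^ 2 * z ^ 2 ≤ 1)
    {x : E} (hx : ‖x‖ ≤ P) :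
    b ^ finrank ℝ E * (a / b) / 2 * (t / P) ^ finrank ℝ E * μ.real (closedBall (0 : E) s) ≤
      μ.real (closedBall 0 s ∩ closedBall x t) := by
  obtain ⟨e, he, hxe⟩ : ∃ e : E, ‖e‖ = 1 ∧ x = ‖x‖ • e := by
    by_cases h0 : x = 0
    · obtain ⟨e, he⟩ := exists_norm_eq E zero_le_one
      exact ⟨e, he, by simp [h0]⟩
    · exact ⟨‖x‖⁻¹ • x, by simp [norm_smul, h0], by simp [smul_smul, h0]⟩
  set ρ := ‖x‖ with hρ
  have hρ0 : 0 ≤ ρ := norm_nonneg x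
  have hdist (z : E) : ‖x - z‖ ^ 2 = ρ ^ 2 - 2 * ρ * inner ℝ e z + ‖z‖ ^ 2 := by
    rw [norm_sub_sq_real, ← hρ]
    nth_rewrite 1 [hxe]
    rw [real_inner_smul_left]; ring
  have hconst : b ^ finrank ℝ E * (a / b) / 2 * (t / P) ^ finrank ℝ E *
      μ.real (closedBall (0 : E) s) = (t * s / P) ^ finrank ℝ E * (b ^ finrank ℝ E * (a / b)) *
        (μ.real (ball (0 : E) 1) / 2) := by
    rw [Measure.addHaar_real_closedBall μ _ hs.le, div_pow, div_pow, mul_pow]; ring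
  have hfin : μ (closedBall 0 s ∩ closedBall x t) ≠ ⊤ :=
    measure_ne_top_of_subset Set.inter_subset_left measure_closedBall_lt_top.ne
  rw [hconst]
  rcases le_total t s with hle | hle
  · refine (measure_cap_ge μ he (r := t) (k := t ^ 2 / P) (h := t * s / P) ht.le (by positivity)
      (by rw [sq]; gcongr) (by field_simp; linear_combination hst) ha hb hab).trans ?_
    have hcap : (fun z => x - z) ⁻¹' {z : E | ‖z‖ ≤ t ∧ t ^ 2 / P ≤ inner ℝ e z} ⊆
        closedBall 0 s ∩ closedBall x t := by
      rintro z ⟨hz1, hz2⟩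
      refine ⟨?_, by simpa [dist_eq_norm, norm_sub_rev] using hz1⟩
      rw [mem_closedBall_zero_iff]
      refine abs_le_of_sq_le_sq' ?_ hs.le |>.2
      have h1 := hdist (x - z)
      rw [sub_sub_cancel] at h1
      have h2 : ‖x - z‖ ^ 2 ≤ t ^ 2 := by gcongr
      have h3 : 2 * ρ * (t ^ 2 / P) ≤ 2 * ρ * inner ℝ e (x - z) := by gcongr
      have h4 : ρ ^ 2 - 2 * ρ * (t ^ 2 / P) + t ^ 2 ≤ s ^ 2 := by
        have : P * (ρ ^ 2 - 2 * ρ * (t ^ 2 / P) + t ^ 2 - s ^ 2) ≤ 0 := by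
          have e1 : P * (ρ ^ 2 - 2 * ρ * (t ^ 2 / P) + t ^ 2 - s ^ 2) =
            P * ρ ^ 2 - 2 * ρ * t ^ 2 + P * t ^ 2 - P * s ^ 2 := by field_simp
          rw [e1]
          have hts : t ^ 2 ≤ s ^ 2 := by gcongr
          nlinarith [mul_nonneg hρ0 (sub_nonneg.2 hx),
            mul_nonneg (sub_nonneg.2 hx) (sub_nonneg.2 hts),
            mul_nonneg hP.le (mul_nonneg hρ0 (sub_nonneg.2 hx))]
        nlinarith
      linarith
    calc _ = μ.real ((fun z => x - z) ⁻¹' {z : E | ‖z‖ ≤ t ∧ t ^ 2 / P ≤ inner ℝ e z}) := by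
          rw [measureReal_def, measureReal_def]
          congr 1
          have hclosed : IsClosed ({z : E | ‖z‖ ≤ t} ∩ {z | t ^ 2 / P ≤ inner ℝ e z}) :=
            (isClosed_le (by fun_prop) (by fun_prop)).inter
              (isClosed_le (by fun_prop) (by fun_prop))
          exact ((Measure.measurePreserving_sub_left μ x).measure_preimage
            hclosed.measurableSet.nullMeasurableSet).symm
      _ ≤ _ := measureReal_mono hcap hfin
  · refine (measure_cap_ge μ he (r := s) (k := s ^ 2 / P) (h := t * s / P) hs.le (by positivity)
      (by rw [sq]; gcongr) (by field_simp; linear_combination hst) ha hb hab).trans ?_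
    refine measureReal_mono ?_ hfin
    rintro z ⟨hz1, hz2⟩
    refine ⟨by simpa using hz1, ?_⟩
    rw [mem_closedBall, dist_comm, dist_eq_norm]
    refine abs_le_of_sq_le_sq' ?_ ht.le |>.2
    have h1 := hdist z
    have h2 : ‖z‖ ^ 2 ≤ s ^ 2 := by gcongr
    have h3 : 2 * ρ * (s ^ 2 / P) ≤ 2 * ρ * inner ℝ e z := by gcongr
    have h4 : ρ ^ 2 - 2 * ρ * (s ^ 2 / P) + s ^ 2 ≤ t ^ 2 := by
      have : P * (ρ ^ 2 - 2 * ρ * (s ^ 2 / P) + s ^ 2 - t ^ 2) ≤ 0 := by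
        have e1 : P * (ρ ^ 2 - 2 * ρ * (s ^ 2 / P) + s ^ 2 - t ^ 2) =
          P * ρ ^ 2 - 2 * ρ * s ^ 2 + P * s ^ 2 - P * t ^ 2 := by field_simp
        rw [e1]
        have hts : s ^ 2 ≤ t ^ 2 := by gcongr
        nlinarith [mul_nonneg hρ0 (sub_nonneg.2 hx),
          mul_nonneg (sub_nonneg.2 hx) (sub_nonneg.2 hts),
          mul_nonneg hP.le (mul_nonneg hρ0 (sub_nonneg.2 hx))]
      nlinarith
    linarith

/-- The centres chosen greedily, completed by those of a separated cover of the points they miss. -/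
lemma exists_finset_unit_cover_closedBall [Nontrivial E] {R δ a b p : ℝ} (hR : 1 ≤ R) (hδ : 0 < δ)
    (hδ' : 2 * δ ≤ 1) (ha : 0 < a) (hb : 0 < b)
    (hab : ∀ z : ℝ, 0 ≤ z → 2 * a * z + b ^ 2 * (1 - z ^ 2) + a ^ 2 * z ^ 2 ≤ 1)
    (hp : p = b ^ finrank ℝ E * (a / b) / 2 * ((1 - δ) / (R + δ)) ^ finrank ℝ E) :
    ∃ C : Finset E,
      (C.card : ℝ) ≤ finrank ℝ E * log δ⁻¹ / p + 1 + (R + δ) ^ finrank ℝ E ∧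
      ∀ x : E, ‖x‖ ≤ R → ∃ y ∈ C, dist x y ≤ 1 := by
  classical
  let μ : Measure E := volume
  set n := finrank ℝ E with hn
  have ht : 0 < 1 - δ := by linarith
  have hP : 0 < R + δ := by linarith
  have hp0 : 0 < p := by rw [hp]; positivity
  have hs2 : 0 < (R + δ) ^ 2 - (1 - δ) ^ 2 := by nlinarith
  set s := √((R + δ) ^ 2 - (1 - δ) ^ 2) with hs
  have hs0 : 0 < s := sqrt_pos.2 hs2
  have hst : s ^ 2 + (1 - δ) ^ 2 = (R + δ) ^ 2 := by rw [hs, sq_sqrt hs2.le]; ring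
  have hcap : ∀ x ∈ closedBall (0 : E) (R + δ), p * μ.real (closedBall (0 : E) s) ≤
      μ.real (closedBall 0 s ∩ closedBall x (1 - δ)) := fun x hx => by
    rw [hp]
    exact measure_inter_closedBall_ge μ ht hs0 hP hst ha hb hab (by simpa using hx)
  have hS0 : μ (closedBall (0 : E) s) ≠ 0 := (measure_closedBall_pos μ 0 hs0).ne'
  have hS' : μ (closedBall (0 : E) s) ≠ ⊤ := measure_closedBall_lt_top.ne
  have hp1 : p ≤ 1 := by
    have h1 := (hcap 0 (by simpa using hP.le)).trans (measureReal_mono Set.inter_subset_left hS')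
    exact le_of_mul_le_mul_right (h1.trans_eq (one_mul _).symm) (ENNReal.toReal_pos hS0 hS')
  have hlog : 0 ≤ n * log δ⁻¹ / p := by
    have : 0 ≤ log δ⁻¹ := log_nonneg ((one_le_inv₀ hδ).2 (by linarith))
    positivity
  set N := ⌈n * log δ⁻¹ / p⌉₊ with hN
  obtain ⟨Y, hYN, hYU⟩ := exists_finset_measure_diff_le μ measurableSet_closedBall hS0 hS'
    measurableSet_closedBall measure_closedBall_lt_top.ne hp1 hcap N
  set U := closedBall (0 : E) (R + δ) \ ⋃ y ∈ Y, closedBall y (1 - δ) with hU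
  obtain ⟨M, hMU, hM⟩ := exists_finset_unit_cover μ
    (A := {x : E | ‖x‖ ≤ R ∧ ∀ y ∈ Y, 1 < dist x y}) (U := U) hδ hδ'
    (measure_ne_top_of_subset Set.sdiff_subset measure_closedBall_lt_top.ne) (by
      rintro x ⟨hxR, hxY⟩ z hz
      rw [mem_ball] at hz
      refine ⟨?_, ?_⟩
      · rw [mem_closedBall]
        have := dist_triangle z x 0
        rw [dist_zero_right x] at this
        linarith
      · simp only [Set.mem_iUnion, mem_closedBall, not_exists, not_le]
        intro y hy
        have := dist_triangle x z y
        rw [dist_comm x z] at this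
        linarith [hxY y hy])
  refine ⟨Y ∪ M, ?_, fun x hx => ?_⟩
  · have hv : 0 < μ.real (ball (0 : E) 1) :=
      ENNReal.toReal_pos (measure_ball_pos μ 0 one_pos).ne' measure_ball_lt_top.ne
    have hpow : (1 - p) ^ N ≤ δ ^ n := by
      calc (1 - p) ^ N ≤ exp (-p) ^ N := by
            exact pow_le_pow_left₀ (by linarith) (by linarith [add_one_le_exp (-p)]) N
        _ = exp (-(p * N)) := by rw [← exp_nat_mul]; ring_nf
        _ ≤ exp (n * log δ) := by
            gcongr
            have := (div_le_iff₀ hp0).1 (Nat.le_ceil (n * log δ⁻¹ / p))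
            rw [log_inv] at this
            rw [hN, log_inv]
            linarith
        _ = δ ^ n := by rw [exp_nat_mul, exp_log hδ]
    have hM' : (M.card : ℝ) ≤ (R + δ) ^ n := by
      have h1 : (M.card : ℝ) * (δ ^ n * μ.real (ball (0 : E) 1)) ≤
          (R + δ) ^ n * (δ ^ n * μ.real (ball (0 : E) 1)) := by
        calc _ ≤ _ := hMU
          _ ≤ _ := hYU
          _ ≤ δ ^ n * μ.real (closedBall (0 : E) (R + δ)) := by gcongr
          _ = _ := by rw [Measure.addHaar_real_closedBall μ _ hP.le]; ring
      exact le_of_mul_le_mul_right h1 (by positivity)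
    have hY' : (Y.card : ℝ) ≤ n * log δ⁻¹ / p + 1 :=
      (Nat.cast_le.2 hYN).trans (Nat.ceil_lt_add_one hlog).le
    have : ((Y ∪ M).card : ℝ) ≤ Y.card + M.card := by exact_mod_cast card_union_le Y M
    linarith
  · by_cases h : ∀ y ∈ Y, 1 < dist x y
    · obtain ⟨y, hy, hxy⟩ := hM x ⟨hx, h⟩
      exact ⟨y, mem_union_right _ hy, hxy⟩
    · push Not at h
      obtain ⟨y, hy, hxy⟩ := h
      exact ⟨y, mem_union_left _ hy, hxy⟩

lemma exists_finset_unit_cover_closedBall_three_pow {R : ℝ} (hR : 1 ≤ R) :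
    ∃ C : Finset E, (C.card : ℝ) ≤ 3 ^ finrank ℝ E * R ^ finrank ℝ E ∧
      ∀ x : E, ‖x‖ ≤ R → ∃ y ∈ C, dist x y ≤ 1 := by
  let μ : Measure E := volume
  obtain ⟨C, hC, hcov⟩ := exists_finset_unit_cover μ (A := closedBall (0 : E) R)
    (U := closedBall (0 : E) (R + 1 / 2)) (δ := 1 / 2) (by norm_num) (by norm_num)
    measure_closedBall_lt_top.ne (fun x hx => by
      refine ball_subset_closedBall.trans (closedBall_subset_closedBall' ?_)
      linarith [mem_closedBall.1 hx])
  refine ⟨C, ?_, fun x hx => hcov x (by simpa using hx)⟩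
  have hv : 0 < μ.real (ball (0 : E) 1) :=
    ENNReal.toReal_pos (measure_ball_pos μ 0 one_pos).ne' measure_ball_lt_top.ne
  rw [Measure.addHaar_real_closedBall μ _ (by linarith), ← mul_assoc] at hC
  have h1 := le_of_mul_le_mul_right hC hv
  rw [one_div, inv_pow, ← div_eq_mul_inv, div_le_iff₀ (by positivity), ← mul_pow] at h1
  rw [← mul_pow]
  refine h1.trans (pow_le_pow_left₀ (by positivity) (by linarith) _)

lemma half_ellipsoid_bound {n : ℕ} (hn : 6 ≤ n) (z : ℝ) :
    2 * (4 / (5 * √n)) * z + (1 - 1 / (2 * n : ℝ)) ^ 2 * (1 - z ^ 2) +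
      (4 / (5 * √n)) ^ 2 * z ^ 2 ≤ 1 := by
  have hn' : (6 : ℝ) ≤ n := by exact_mod_cast hn
  have hsq : √(n : ℝ) ^ 2 = n := sq_sqrt (by positivity)
  have hs : 0 < √(n : ℝ) := sqrt_pos.2 (by linarith)
  set q := √(n : ℝ) with hq
  set m := (1 : ℝ) / n with hm
  have hm0 : 0 < m := by positivity
  have hm6 : m ≤ 1 / 6 := by rw [hm]; gcongr
  set u := z / q with hu
  have hmq : m * q ^ 2 = 1 := by rw [hsq, hm]; field_simp
  have hz : z ^ 2 = u ^ 2 * q ^ 2 := by rw [hu]; field_simp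
  have e1 : 2 * (4 / (5 * q)) * z = 8 / 5 * u := by rw [hu]; field_simp; ring
  have e2 : (4 / (5 * q)) ^ 2 * z ^ 2 = 16 / 25 * u ^ 2 := by rw [hu]; field_simp; ring
  have e3 : 1 / (2 * n : ℝ) = m / 2 := by rw [hm]; field_simp
  rw [e1, e2, e3]
  set t := u * q ^ 2 with ht
  have hut : u = m * t := by rw [ht]; linear_combination (-u) * hmq
  have hz' : z ^ 2 = m * t ^ 2 := by rw [hz, ht]; linear_combination (-u ^ 2 * q ^ 2) * hmq
  rw [hz', hut]
  have h1 : 0 ≤ (1 - m / 4) - 8 / 5 * t + ((1 - m / 2) ^ 2 - 16 / 25 * m) * t ^ 2 := by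
    have h2 : 11 / 15 * t ^ 2 ≤ ((1 - m / 2) ^ 2 - 16 / 25 * m) * t ^ 2 := by
      gcongr
      nlinarith
    nlinarith [sq_nonneg (t - 12 / 11)]
  nlinarith [mul_nonneg hm0.le h1]

lemma log_two_mul_le {x : ℝ} (hx : 6 ≤ x) : log (2 * x) ≤ 11 / 25 * x := by
  have h1 := log_le_sub_one_of_pos (x := 2 * x / exp 2) (by positivity)
  rw [log_div (by positivity) (exp_pos 2).ne', log_exp] at h1
  have h2 : (7.38 : ℝ) ≤ exp 2 := by
    have := exp_one_gt_d9
    have h3 : exp 2 = exp 1 * exp 1 := by rw [← exp_add]; norm_num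
    rw [h3]; nlinarith
  have h3 : 2 * x / exp 2 ≤ 2 * x / 7.38 := by gcongr
  have h4 : 2 * x / 7.38 = x * (2 / 7.38) := by ring
  norm_num at h3 h4
  linarith

lemma radius_ratio_pow_le {n : ℕ} (hn : 6 ≤ n) :
    ((1 + 1 / (2 * n : ℝ)) / (1 - 1 / (2 * n : ℝ))) ^ n ≤ 3 := by
  have hn' : (6 : ℝ) ≤ n := by exact_mod_cast hn
  have hpos : (0 : ℝ) < 2 * n - 1 := by linarith
  have e : (1 + 1 / (2 * n : ℝ)) / (1 - 1 / (2 * n : ℝ)) = 2 / (2 * n - 1) + 1 := by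
    have : (1 - 1 / (2 * n : ℝ)) = (2 * n - 1) / (2 * n) := by field_simp
    rw [this]; field_simp; ring
  calc _ ≤ exp (2 / (2 * n - 1)) ^ n := by
        rw [e]; gcongr; exact add_one_le_exp _
    _ = exp (n * (2 / (2 * n - 1))) := (exp_nat_mul _ _).symm
    _ ≤ exp (1 + 1 / 11) := by
        gcongr
        rw [mul_div_assoc', div_le_iff₀ hpos]; linarith
    _ ≤ 3 := by
        rw [exp_add]
        have h1 := exp_one_lt_d9
        have h2 : exp (1 / 11) ≤ 11 / 10 := by
          have := one_sub_le_exp_neg (1 / 11 : ℝ)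
          rw [exp_neg, le_inv_comm₀ (by norm_num) (exp_pos _)] at this
          norm_num at this ⊢
          exact this
        nlinarith [exp_pos 1, exp_pos (1 / 11)]

lemma half_ellipsoid_axis_pow_ge {n : ℕ} (hn : 1 ≤ n) :
    3 / 5 ≤ (1 - 1 / (2 * n : ℝ)) ^ n / (1 - 1 / (2 * n : ℝ)) := by
  obtain ⟨k, rfl⟩ := Nat.exists_eq_succ_of_ne_zero (by omega : n ≠ 0)
  have hk : (0 : ℝ) ≤ k := by positivity
  push_cast
  have e : 1 - 1 / (2 * ((k : ℝ) + 1)) = (1 / (2 * (k : ℝ) + 1) + 1)⁻¹ := by field_simp; ring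
  rw [pow_succ, mul_div_cancel_right₀ _ (by rw [e]; positivity), e, inv_pow,
    le_inv_comm₀ (by norm_num) (by positivity)]
  calc (1 / (2 * k + 1) + 1 : ℝ) ^ k ≤ exp (1 / (2 * k + 1)) ^ k := by
        gcongr; exact add_one_le_exp _
    _ = exp (k * (1 / (2 * k + 1))) := (exp_nat_mul _ _).symm
    _ ≤ exp (1 / 2) := by
        gcongr
        rw [mul_one_div, div_le_div_iff₀ (by positivity) (by norm_num)]; linarith
    _ ≤ (3 / 5)⁻¹ := by
        refine abs_le_of_sq_le_sq' ?_ (by norm_num) |>.2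
        rw [← exp_nat_mul]
        have := exp_one_lt_d9
        norm_num
        linarith

/-- The ball of radius `R ≥ 1` in an `n`-dimensional Euclidean space is covered by
at most `6 n² √n Rⁿ` unit balls. -/
theorem exists_finset_unit_cover_card_le [Nontrivial E] {R : ℝ} (hR : 1 ≤ R) :
    ∃ C : Finset E, (C.card : ℝ) ≤
        6 * ((finrank ℝ E : ℝ) ^ 2 * √(finrank ℝ E)) * R ^ finrank ℝ E ∧
      ∀ x : E, ‖x‖ ≤ R → ∃ y ∈ C, dist x y ≤ 1 := by
  have hn0 : 0 < finrank ℝ E := finrank_pos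
  rcases lt_or_ge (finrank ℝ E) 6 with hn | hn
  · obtain ⟨C, hC, hcov⟩ := exists_finset_unit_cover_closedBall_three_pow (E := E) hR
    refine ⟨C, hC.trans ?_, hcov⟩
    gcongr
    generalize finrank ℝ E = n at hn hn0
    have h1 : (1 : ℝ) ≤ √1 := by simp
    have h2 : (7 / 5 : ℝ) ≤ √2 := le_sqrt_of_sq_le (by norm_num)
    have h3 : (17 / 10 : ℝ) ≤ √3 := le_sqrt_of_sq_le (by norm_num)
    have h4 : (2 : ℝ) ≤ √4 := le_sqrt_of_sq_le (by norm_num)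
    have h5 : (11 / 5 : ℝ) ≤ √5 := le_sqrt_of_sq_le (by norm_num)
    interval_cases n <;> norm_num <;> linarith
  set n := finrank ℝ E with hnE
  have hn' : (6 : ℝ) ≤ n := by exact_mod_cast hn
  have hs : 0 < √(n : ℝ) := sqrt_pos.2 (by linarith)
  set δ : ℝ := 1 / (2 * n) with hδ
  have hδ0 : 0 < δ := by positivity
  have hδ1 : δ ≤ 1 / 12 := by rw [hδ]; gcongr; linarith
  set p : ℝ := (1 - δ) ^ n * (4 / (5 * √n) / (1 - δ)) / 2 * ((1 - δ) / (R + δ)) ^ n with hp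
  obtain ⟨C, hC, hcov⟩ := exists_finset_unit_cover_closedBall (E := E) hR hδ0 (by linarith)
    (a := 4 / (5 * √n)) (b := 1 - δ) (by positivity) (by linarith)
    (fun z _ => half_ellipsoid_bound hn z) hp
  refine ⟨C, hC.trans ?_, hcov⟩
  have hκ : ((1 + δ) / (1 - δ)) ^ n ≤ 3 := radius_ratio_pow_le hn
  have hRn : 1 ≤ R ^ n := one_le_pow₀ hR
  have hPR : R + δ ≤ R * (1 + δ) := by nlinarith
  have h1δ : 0 < 1 - δ := by linarith
  have hP : (R + δ) ^ n ≤ 3 * R ^ n := by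
    calc (R + δ) ^ n ≤ (R * ((1 + δ) / (1 - δ))) ^ n := by
          gcongr
          refine hPR.trans ?_
          gcongr
          rw [le_div_iff₀ h1δ]; nlinarith
      _ = R ^ n * ((1 + δ) / (1 - δ)) ^ n := mul_pow _ _ _
      _ ≤ R ^ n * 3 := by gcongr
      _ = _ := mul_comm _ _
  have hpinv : 6 / (25 * √n) * (1 / (3 * R ^ n)) ≤ p := by
    have h1 : 6 / (25 * √n) ≤ (1 - δ) ^ n * (4 / (5 * √n) / (1 - δ)) / 2 := by
      calc 6 / (25 * √n) = 3 / 5 * (4 / (5 * √n) / 2) := by field_simp; norm_num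
        _ ≤ (1 - δ) ^ n / (1 - δ) * (4 / (5 * √n) / 2) := by
            exact mul_le_mul_of_nonneg_right (half_ellipsoid_axis_pow_ge hn0) (by positivity)
        _ = _ := by ring
    have h2 : 1 / (3 * R ^ n) ≤ ((1 - δ) / (R + δ)) ^ n := by
      rw [← inv_div (R + δ), inv_pow, one_div]
      gcongr
      calc ((R + δ) / (1 - δ)) ^ n ≤ (R * ((1 + δ) / (1 - δ))) ^ n := by
            rw [mul_div_assoc']; gcongr
        _ = R ^ n * ((1 + δ) / (1 - δ)) ^ n := mul_pow _ _ _
        _ ≤ R ^ n * 3 := by gcongr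
        _ = _ := mul_comm _ _
    rw [hp]; gcongr
  have hlog : log δ⁻¹ ≤ 11 / 25 * n := by
    rw [hδ, one_div, inv_inv]; exact log_two_mul_le hn'
  have hmain : n * log δ⁻¹ / p ≤ 11 / 2 * ((n : ℝ) ^ 2 * √n) * R ^ n := by
    calc n * log δ⁻¹ / p ≤ n * (11 / 25 * n) / (6 / (25 * √n) * (1 / (3 * R ^ n))) := by gcongr
      _ = _ := by field_simp; norm_num
  have hs2 : 2 ≤ √(n : ℝ) := le_sqrt_of_sq_le (by linarith)
  have hbig : 8 ≤ (n : ℝ) ^ 2 * √n := by nlinarith [mul_le_mul hn' hn' (by norm_num) (by linarith)]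
  nlinarith
end

/-- Gaussian type-class covering bound (sphere covering, Verger-Gaugry): for
Λ > D > 0 and n ≥ 1, the Euclidean ball of radius √(nΛ) in ℝⁿ can be covered
by at most 6·n^{5/2}·(Λ/D)^{n/2} balls of radius √(nD). -/
theorem gaussian_type_class_covering
    (n : ℕ) (hn : 1 ≤ n) (Λ D : ℝ) (hD : 0 < D) (hΛD : D < Λ) :
    ∃ B : Finset (Fin n → ℝ),
      (B.card : ℝ) ≤ 6 * (n : ℝ) ^ ((5 : ℝ) / 2) * (Λ / D) ^ ((n : ℝ) / 2) ∧
      ∀ x : Fin n → ℝ, (∑ i, x i ^ 2) ≤ n * Λ →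
        ∃ y ∈ B, (∑ i, (x i - y i) ^ 2) ≤ n * D := by
  classical
  have : Nonempty (Fin n) := ⟨⟨0, hn⟩⟩
  have hn0 : (0 : ℝ) < n := by exact_mod_cast hn
  have hΛD' : 1 < Λ / D := (one_lt_div hD).2 hΛD
  have hR : 1 ≤ √(Λ / D) := one_le_sqrt.2 hΛD'.le
  obtain ⟨C, hC, hcov⟩ := exists_finset_unit_cover_card_le (E := EuclideanSpace ℝ (Fin n)) hR
  rw [finrank_euclideanSpace_fin] at hC
  have hnD : 0 < n * D := by positivity
  set c := √(n * D) with hc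
  have hc0 : 0 < c := sqrt_pos.2 hnD
  have hc2 : c ^ 2 = n * D := sq_sqrt hnD.le
  refine ⟨C.image fun y i => c * y i, ?_, fun x hx => ?_⟩
  · refine (Nat.cast_le.2 card_image_le).trans (hC.trans_eq ?_)
    have e1 : (n : ℝ) ^ ((5 : ℝ) / 2) = (n : ℝ) ^ 2 * √n := by
      rw [sqrt_eq_rpow, ← rpow_natCast, ← rpow_add hn0]; norm_num
    have e2 : (Λ / D) ^ ((n : ℝ) / 2) = √(Λ / D) ^ n := by
      rw [sqrt_eq_rpow, ← rpow_natCast, ← rpow_mul (by positivity)]; ring_nf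
    rw [e1, e2]
  · obtain ⟨y, hy, hxy⟩ := hcov (WithLp.toLp 2 fun i => x i / c) (by
      rw [EuclideanSpace.norm_eq]
      apply sqrt_le_sqrt
      simp only [norm_eq_abs, sq_abs, div_pow, hc2, ← sum_div]
      rw [div_le_iff₀ hnD]
      refine hx.trans_eq ?_
      field_simp)
    refine ⟨_, mem_image_of_mem _ hy, ?_⟩
    rw [EuclideanSpace.dist_eq, sqrt_le_one] at hxy
    calc ∑ i, (x i - c * y i) ^ 2 = c ^ 2 * ∑ i, (x i / c - y i) ^ 2 := by
          rw [mul_sum]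
          refine sum_congr rfl fun i _ => ?_
          field_simp
      _ ≤ c ^ 2 * 1 := by
          gcongr
          simpa [dist_eq] using hxy
      _ = n * D := by rw [hc2, mul_one]
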